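/- (Proposition 5.2, measure-family form) Let 𝒪 ⊆ ℝ⁴ be open and convex with V₊ ⊆ 𝒪, let B ⊆ V₊ be compact, and let (ρ_x)_{x∈𝒪} be a family of Borel probability measures on ℝ⁴ with supp ρ_x ⊆ B for all x. Assume: (i) for every positive lightlike p, the function F_p(x) := ∫ e^{i β·p} dρ_x(β) is smooth on 𝒪 and satisfies Σ_ν pᵥ ∂_ν F_p(x) = 0 and □F_p(x) = 0 on 𝒪; (ii) for every unit vector 𝐞 ∈ ℝ³ and every m ∈ ℕ, the function x ↦ ∫ (e·β)^m dρ_x(β), with e = (1, 𝐞), is smooth on 𝒪. Then at least one of the following holds: (a) for every unit vector 𝐞 ∈ ℝ³ and every m ∈ ℕ, the function x ↦ ∫ (e·β)^m dρ_x(β) is constant on 𝒪; or (b) there exist four linearly independent positive lightlike vectors e₁, e₂, e₃, e₄ ∈ ℝ⁴ and real constants c₁, c₂, c₃, c₄ such that 𝒪 ⊆ ∩_{i=1}^4 {x ∈ ℝ⁴ : eᵢ·x ≥ cᵢ}; i.e. 𝒪 is contained in a timelike simplicial cone (an intersection of four characteristic half-spaces). -/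

import Mathlib

open MeasureTheory

noncomputable section

/-- Minkowski inner product on ℝ⁴: x·y = x₀y₀ − x₁y₁ − x₂y₂ − x₃y₃. -/
def mink (x y : Fin 4 → ℝ) : ℝ := x 0 * y 0 - x 1 * y 1 - x 2 * y 2 - x 3 * y 3

/-- Partial derivative in the ν-th coordinate direction. -/
def pd {E : Type*} [NormedAddCommGroup E] [NormedSpace ℝ E]
    (ν : Fin 4) (f : (Fin 4 → ℝ) → E) (x : Fin 4 → ℝ) : E :=
  fderiv ℝ f x (Pi.single ν 1)

/-- The d'Alembertian □ = ∂₀² − ∂₁² − ∂₂² − ∂₃². -/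
def box {E : Type*} [NormedAddCommGroup E] [NormedSpace ℝ E]
    (f : (Fin 4 → ℝ) → E) (x : Fin 4 → ℝ) : E :=
  pd 0 (pd 0 f) x - pd 1 (pd 1 f) x - pd 2 (pd 2 f) x - pd 3 (pd 3 f) x

/-- The open forward light cone V₊ = {x : x₀ > 0, x·x > 0}. -/
def Vplus : Set (Fin 4 → ℝ) := {x | 0 < x 0 ∧ 0 < mink x x}

/-- A vector p is positive lightlike if p ≠ 0, p·p = 0 and p₀ > 0. -/
def PosLightlike (p : Fin 4 → ℝ) : Prop := p ≠ 0 ∧ mink p p = 0 ∧ 0 < p 0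

/-- The positive lightlike vector e = (1, 𝐞) associated with a unit vector
𝐞 ∈ ℝ³. -/
def lightOne (e : EuclideanSpace ℝ (Fin 3)) : Fin 4 → ℝ :=
  Fin.cons 1 (fun i => e i)

lemma PosLightlike.smul {p : Fin 4 → ℝ} (hp : PosLightlike p) {r : ℝ} (hr : 0 < r) :
    PosLightlike (r • p) := by
  obtain ⟨h0, h1, h2⟩ := hp
  refine ⟨smul_ne_zero hr.ne' h0, ?_, by simpa using mul_pos hr h2⟩
  simp only [mink, Pi.smul_apply, smul_eq_mul] at h1 ⊢
  linear_combination r ^ 2 * h1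

lemma posLightlike_of_zero_eq_one {p : Fin 4 → ℝ} (h0 : p 0 = 1) (h : mink p p = 0) :
    PosLightlike p :=
  ⟨fun h' => by simp [h'] at h0, h, by rw [h0]; exact one_pos⟩

lemma PosLightlike.exists_eq_smul_lightOne {p : Fin 4 → ℝ} (hp : PosLightlike p) :
    ∃ e : EuclideanSpace ℝ (Fin 3), ‖e‖ = 1 ∧ p = p 0 • lightOne e := by
  obtain ⟨-, h1, h2⟩ := hp
  refine ⟨WithLp.toLp 2 ![p 1 / p 0, p 2 / p 0, p 3 / p 0], ?_, ?_⟩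
  · rw [EuclideanSpace.norm_eq, Real.sqrt_eq_one]
    simp only [Fin.sum_univ_three, Real.norm_eq_abs, sq_abs]
    simp only [mink] at h1
    simp
    field_simp
    linarith
  · ext i
    fin_cases i <;> simp [lightOne] <;> field_simp

lemma mink_lightOne_self {e : EuclideanSpace ℝ (Fin 3)} (he : ‖e‖ = 1) :
    mink (lightOne e) (lightOne e) = 0 := by
  rw [EuclideanSpace.norm_eq, Real.sqrt_eq_one] at he
  simp only [Fin.sum_univ_three, Real.norm_eq_abs, sq_abs] at he
  have h (i : Fin 3) : lightOne e i.succ = e i := rfl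
  have h1 := h 0
  have h2 := h 1
  have h3 := h 2
  simp only [Fin.succ_zero_eq_one, Fin.succ_one_eq_two, Fin.reduceSucc] at h1 h2 h3
  have h0 : lightOne e 0 = 1 := rfl
  rw [mink, h0, h1, h2, h3]
  linarith

lemma continuous_mink_right (p : Fin 4 → ℝ) : Continuous fun β => mink p β := by
  unfold mink; fun_prop

/-- The recession cone of an open convex set containing the forward light cone contains every
positive lightlike vector. -/
lemma add_smul_mem_of_posLightlike {O : Set (Fin 4 → ℝ)} (hOopen : IsOpen O)
    (hOconv : Convex ℝ O) (hOV : Vplus ⊆ O) {x p : Fin 4 → ℝ} (hx : x ∈ O)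
    (hp : PosLightlike p) {t : ℝ} (ht : 0 ≤ t) : x + t • p ∈ O := by
  set τ : Fin 4 → ℝ := Pi.single 0 1
  have hcont : ContinuousAt (fun l : ℝ => (1 - l)⁻¹ • (x - l • τ)) 0 := by
    have : ContinuousAt (fun l : ℝ => (1 - l)⁻¹) 0 :=
      ContinuousAt.inv₀ (by fun_prop) (by norm_num)
    exact this.smul (by fun_prop)
  have hmem : ∀ᶠ l : ℝ in nhds 0, (1 - l)⁻¹ • (x - l • τ) ∈ O :=
    hcont.eventually_mem (by simpa using hOopen.mem_nhds hx)
  obtain ⟨ε, hε, hball⟩ := Metric.eventually_nhds_iff.1 hmem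
  set l := min (ε / 2) (1 / 2)
  have hl0 : 0 < l := by positivity
  have hl1 : l ≤ 1 / 2 := min_le_right _ _
  have hlε : l ≤ ε / 2 := min_le_left _ _
  have h1 := hball (y := l) (by rw [Real.dist_eq, sub_zero, abs_of_pos hl0]; linarith)
  have h2 : (t / l) • p + τ ∈ Vplus := by
    obtain ⟨-, hp1, hp2⟩ := hp
    have hq : 0 ≤ t / l * p 0 := by positivity
    simp only [mink] at hp1
    refine ⟨by simp [τ]; linarith, ?_⟩
    simp only [mink, τ, Pi.add_apply, Pi.smul_apply, smul_eq_mul]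
    simp
    nlinarith [congrArg (fun z => (t / l) ^ 2 * z) hp1]
  have h3 := hOconv h1 (hOV h2) (by linarith : 0 ≤ 1 - l) hl0.le (by ring)
  convert h3 using 1
  have : 1 - l ≠ 0 := by linarith
  rw [smul_smul, mul_inv_cancel₀ this, smul_add, smul_smul, mul_div_cancel₀ _ hl0.ne']
  module

section Rays

variable {E F : Type*} [NormedAddCommGroup E] [NormedSpace ℝ E]
  [NormedAddCommGroup F] [NormedSpace ℝ F]

lemma hasDerivAt_comp_ray {g : E → F} {x v : E} {t : ℝ} (hg : DifferentiableAt ℝ g (x + t • v)) :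
    HasDerivAt (fun t : ℝ => g (x + t • v)) (fderiv ℝ g (x + t • v) v) t := by
  have h1 : HasDerivAt (fun t : ℝ => x + t • v) v t := by
    simpa using ((hasDerivAt_id t).smul_const v).const_add x
  exact hg.hasFDerivAt.comp_hasDerivAt t h1

lemma eq_of_fderiv_apply_eq_zero_on_ray {O : Set E} {g : E → F} {v : E}
    (hg : ∀ x ∈ O, DifferentiableAt ℝ g x) (hz : ∀ x ∈ O, fderiv ℝ g x v = 0)
    {x : E} (hray : ∀ t : ℝ, 0 ≤ t → x + t • v ∈ O) {t : ℝ} (ht : 0 ≤ t) :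
    g (x + t • v) = g x := by
  have h := constant_of_has_deriv_right_zero (f := fun t : ℝ => g (x + t • v)) (a := 0) (b := t)
    (fun s hs => (hasDerivAt_comp_ray (hg _ (hray s hs.1))).continuousAt.continuousWithinAt)
    (fun s hs => by
      have := hasDerivAt_comp_ray (hg _ (hray s hs.1))
      rw [hz _ (hray s hs.1)] at this
      exact this.hasDerivWithinAt) t ⟨ht, le_rfl⟩
  simpa using h

/-- A function that is bounded along a ray and whose derivative along the ray is constant has
vanishing derivative along the ray. -/
lemma fderiv_apply_eq_zero_of_bounded_ray {g : E → ℝ} {x v : E} {C : ℝ}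
    (hg : ∀ t : ℝ, 0 ≤ t → DifferentiableAt ℝ g (x + t • v))
    (hC : ∀ t : ℝ, 0 ≤ t → |g (x + t • v)| ≤ C)
    (hconst : ∀ t : ℝ, 0 ≤ t → fderiv ℝ g (x + t • v) v = fderiv ℝ g x v) :
    fderiv ℝ g x v = 0 := by
  set κ := fderiv ℝ g x v
  have hlin : ∀ t : ℝ, 0 < t → κ * t = g (x + t • v) - g (x + (0 : ℝ) • v) := by
    intro t ht
    obtain ⟨c, hc, h⟩ := exists_deriv_eq_slope (fun t : ℝ => g (x + t • v)) ht
      (fun s hs => (hasDerivAt_comp_ray (hg s hs.1)).continuousAt.continuousWithinAt)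
      (fun s hs => (hasDerivAt_comp_ray (hg s hs.1.le)).differentiableAt.differentiableWithinAt)
    rw [(hasDerivAt_comp_ray (hg c hc.1.le)).deriv, hconst c hc.1.le] at h
    rw [h, sub_zero, div_mul_cancel₀ _ ht.ne']
  by_contra hκ
  have hκ' : 0 < |κ| := abs_pos.2 hκ
  have hC0 : 0 ≤ C := (abs_nonneg _).trans (hC 0 le_rfl)
  set t := (2 * C + 1) / |κ|
  have ht : 0 < t := by positivity
  have h1 : |κ * t| = 2 * C + 1 := by
    rw [abs_mul, abs_of_pos ht, mul_div_cancel₀ _ hκ'.ne']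
  have h2 := abs_sub (g (x + t • v)) (g (x + (0 : ℝ) • v))
  rw [← hlin t ht] at h2
  linarith [hC t ht.le, hC 0 le_rfl]

lemma fderiv_eq_of_ray_invariant {O : Set E} (hO : IsOpen O) {g : E → F} {v : E} {t : ℝ}
    (hinv : ∀ x ∈ O, g (x + t • v) = g x) {x : E} (hx : x ∈ O) :
    fderiv ℝ g (x + t • v) = fderiv ℝ g x := by
  rw [← fderiv_comp_add_right]
  refine Filter.EventuallyEq.fderiv_eq ?_
  filter_upwards [hO.mem_nhds hx] with y hy using hinv y hy

/-- Bounded solutions of the recursive transport system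
`∂_v A₀ = 0`, `∂_v A₁ = -∂_f A₀`, `∂_v A_{k+2} = -∂_f A_{k+1} - ∂_a A_k` are transported along
`v`. -/
lemma fderiv_apply_eq_zero_of_transport_recursion {O : Set E} (hO : IsOpen O) {v f a : E}
    (hray : ∀ x ∈ O, ∀ t : ℝ, 0 ≤ t → x + t • v ∈ O) {A : ℕ → E → ℝ}
    (hA : ∀ k, ∀ x ∈ O, DifferentiableAt ℝ (A k) x) (hb : ∀ k, ∃ C, ∀ x ∈ O, |A k x| ≤ C)
    (h0 : ∀ x ∈ O, fderiv ℝ (A 0) x v = 0)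
    (h1 : ∀ x ∈ O, fderiv ℝ (A 1) x v = -fderiv ℝ (A 0) x f)
    (h2 : ∀ k, ∀ x ∈ O,
      fderiv ℝ (A (k + 2)) x v = -fderiv ℝ (A (k + 1)) x f - fderiv ℝ (A k) x a)
    (k : ℕ) : ∀ x ∈ O, fderiv ℝ (A k) x v = 0 := by
  have hstep : ∀ k, (∀ x ∈ O, ∀ t : ℝ, 0 ≤ t →
      fderiv ℝ (A k) (x + t • v) v = fderiv ℝ (A k) x v) → ∀ x ∈ O, fderiv ℝ (A k) x v = 0 := by
    intro k hk x hx
    obtain ⟨C, hC⟩ := hb k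
    exact fderiv_apply_eq_zero_of_bounded_ray (fun t ht => hA k _ (hray x hx t ht))
      (fun t ht => hC _ (hray x hx t ht)) (hk x hx)
  have hinv : ∀ k, (∀ x ∈ O, fderiv ℝ (A k) x v = 0) → ∀ x ∈ O, ∀ t : ℝ, 0 ≤ t →
      fderiv ℝ (A k) (x + t • v) = fderiv ℝ (A k) x := fun k hk x hx t ht =>
    fderiv_eq_of_ray_invariant hO (fun y hy =>
      eq_of_fderiv_apply_eq_zero_on_ray (hA k) hk (hray y hy) ht) hx
  induction k using Nat.strong_induction_on with
  | _ k ih =>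
    match k, ih with
    | 0, _ => exact h0
    | 1, ih =>
      refine hstep 1 fun x hx t ht => ?_
      rw [h1 x hx, h1 _ (hray x hx t ht), hinv 0 (ih 0 (by omega)) x hx t ht]
    | k + 2, ih =>
      refine hstep (k + 2) fun x hx t ht => ?_
      rw [h2 k x hx, h2 k _ (hray x hx t ht), hinv k (ih k (by omega)) x hx t ht,
        hinv (k + 1) (ih (k + 1) (by omega)) x hx t ht]

end Rays

open Polynomial in
lemma coeff_recursion_of_eval_eq_zero {p q r : ℝ[X]}
    (h : ∀ s : ℝ, p.eval s + s * q.eval s + s ^ 2 * r.eval s = 0) :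
    p.coeff 0 = 0 ∧ p.coeff 1 + q.coeff 0 = 0 ∧
      ∀ k, p.coeff (k + 2) + q.coeff (k + 1) + r.coeff k = 0 := by
  have hz : p + X * q + X ^ 2 * r = 0 := by
    apply Polynomial.funext
    intro s
    simpa using h s
  refine ⟨?_, ?_, fun k => ?_⟩
  · simpa [Polynomial.coeff_X_pow_mul'] using congrArg (fun p => p.coeff 0) hz
  · simpa [Polynomial.coeff_X_pow_mul', Polynomial.coeff_X_mul] using
      congrArg (fun p => p.coeff 1) hz
  · simpa [Polynomial.coeff_X_pow_mul, Polynomial.coeff_X_mul] using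
      congrArg (fun p => p.coeff (k + 2)) hz

section Lagrange

open Polynomial

/-- The Lagrange basis polynomials for the nodes `0, 1, …, N - 1`. -/
def natBasis (N j : ℕ) : ℝ[X] := Lagrange.basis (Finset.range N) (fun i : ℕ => (i : ℝ)) j

lemma eq_sum_eval_mul_natBasis {N : ℕ} {p : ℝ[X]} (hp : p.degree < N) :
    p = ∑ j ∈ Finset.range N, C (p.eval (j : ℝ)) * natBasis N j := by
  have h := Lagrange.eq_interpolate (s := Finset.range N) (v := fun i : ℕ => (i : ℝ)) (f := p)
    (Nat.cast_injective.injOn) (by simpa using hp)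
  rwa [Lagrange.interpolate_apply] at h

lemma degree_quadratic_pow_lt (a b c : ℝ) (m : ℕ) :
    ((C a + C b * X + C c * X ^ 2) ^ m : ℝ[X]).degree < ((2 * m + 1 : ℕ) : WithBot ℕ) := by
  refine (Polynomial.degree_le_natDegree).trans_lt ?_
  have : ((C a + C b * X + C c * X ^ 2) ^ m : ℝ[X]).natDegree ≤ m * 2 :=
    Polynomial.natDegree_pow_le_of_le m (by compute_degree)
  exact_mod_cast (by omega)

lemma quadratic_pow_eq_sum (a b c s : ℝ) (m : ℕ) :
    (a + b * s + c * s ^ 2) ^ m = ∑ j ∈ Finset.range (2 * m + 1),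
      (natBasis (2 * m + 1) j).eval s * (a + b * j + c * (j : ℝ) ^ 2) ^ m := by
  have h := congrArg (eval s) (eq_sum_eval_mul_natBasis (degree_quadratic_pow_lt a b c m))
  simp only [eval_finsetSum, eval_mul, eval_pow, eval_add, eval_C, eval_X] at h
  rw [h]
  exact Finset.sum_congr rfl fun j _ => mul_comm _ _

lemma leading_pow_eq_sum (a b c : ℝ) (m : ℕ) :
    c ^ m = ∑ j ∈ Finset.range (2 * m + 1),
      (natBasis (2 * m + 1) j).coeff (m * 2) * (a + b * j + c * (j : ℝ) ^ 2) ^ m := by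
  have h := congrArg (fun p => p.coeff (m * 2))
    (eq_sum_eval_mul_natBasis (degree_quadratic_pow_lt a b c m))
  have h2 : (C a + C b * X + C c * X ^ 2 : ℝ[X]).coeff 2 = c := by
    simp
  simp only [finsetSum_coeff, coeff_C_mul, eval_pow, eval_add, eval_mul, eval_C, eval_X] at h
  rw [coeff_pow_of_natDegree_le (by compute_degree), h2] at h
  rw [h]
  exact Finset.sum_congr rfl fun j _ => mul_comm _ _

end Lagrange

/-- The moment `x ↦ ∫ (p·β)^m dρ_x(β)`. -/
def nullMoment (ρ : (Fin 4 → ℝ) → Measure (Fin 4 → ℝ)) (m : ℕ) (p x : Fin 4 → ℝ) : ℝ :=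
  ∫ β, mink p β ^ m ∂(ρ x)

section Moments

variable {ρ : (Fin 4 → ℝ) → Measure (Fin 4 → ℝ)} {B O : Set (Fin 4 → ℝ)}

lemma exists_bound_mink_pow (hBc : IsCompact B) (p : Fin 4 → ℝ) (m : ℕ) :
    ∃ C, ∀ β ∈ B, ‖mink p β ^ m‖ ≤ C :=
  hBc.exists_bound_of_continuousOn ((continuous_mink_right p).pow m).continuousOn

lemma integrable_mink_pow (hBc : IsCompact B) (hprob : ∀ x, IsProbabilityMeasure (ρ x))
    (hsupp : ∀ x, ρ x Bᶜ = 0) (p x : Fin 4 → ℝ) (m : ℕ) :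
    Integrable (fun β => mink p β ^ m) (ρ x) := by
  obtain ⟨C, hC⟩ := exists_bound_mink_pow hBc p m
  exact Integrable.of_bound ((continuous_mink_right p).pow m).aestronglyMeasurable C
    (Filter.mem_of_superset (mem_ae_iff.2 (hsupp x)) hC)

lemma exists_bound_nullMoment (hBc : IsCompact B) (hprob : ∀ x, IsProbabilityMeasure (ρ x))
    (hsupp : ∀ x, ρ x Bᶜ = 0) (p : Fin 4 → ℝ) (m : ℕ) :
    ∃ C, ∀ x, |nullMoment ρ m p x| ≤ C := by
  obtain ⟨C, hC⟩ := exists_bound_mink_pow hBc p m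
  refine ⟨C, fun x => ?_⟩
  have h := norm_integral_le_of_norm_le_const (μ := ρ x) (f := fun β => mink p β ^ m)
    (Filter.mem_of_superset (mem_ae_iff.2 (hsupp x)) hC)
  simpa [nullMoment] using h

lemma nullMoment_smul (m : ℕ) (r : ℝ) (p : Fin 4 → ℝ) :
    nullMoment ρ m (r • p) = fun x => r ^ m * nullMoment ρ m p x := by
  ext x
  rw [nullMoment, nullMoment, ← integral_const_mul]
  congr 1 with β
  simp only [mink, Pi.smul_apply, smul_eq_mul]
  rw [← mul_pow]
  ring

lemma differentiableAt_nullMoment (hOopen : IsOpen O)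
    (hmom : ∀ e : EuclideanSpace ℝ (Fin 3), ‖e‖ = 1 → ∀ m : ℕ,
      ContDiffOn ℝ (⊤ : ℕ∞) (fun x => ∫ β, (mink (lightOne e) β) ^ m ∂(ρ x)) O)
    {p : Fin 4 → ℝ} (hp : PosLightlike p) (m : ℕ) {x : Fin 4 → ℝ} (hx : x ∈ O) :
    DifferentiableAt ℝ (nullMoment ρ m p) x := by
  obtain ⟨e, he, hpe⟩ := hp.exists_eq_smul_lightOne
  rw [hpe, nullMoment_smul]
  exact (((hmom e he m).differentiableOn (by simp)).differentiableAt
    (hOopen.mem_nhds hx)).const_mul _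

/-- The push-forwards of the reference measures under `β ↦ β·p` do not change along `p`. -/
lemma map_mink_add_smul (hprob : ∀ x, IsProbabilityMeasure (ρ x)) (hOopen : IsOpen O)
    (hOconv : Convex ℝ O) (hOV : Vplus ⊆ O)
    (hF : ∀ p : Fin 4 → ℝ, PosLightlike p →
      ContDiffOn ℝ (⊤ : ℕ∞)
        (fun x => ∫ β, Complex.exp (Complex.I * ((mink β p : ℝ) : ℂ)) ∂(ρ x)) O ∧
      (∀ x ∈ O, ∑ ν : Fin 4, (p ν : ℂ) *
        pd ν (fun x' => ∫ β, Complex.exp (Complex.I * ((mink β p : ℝ) : ℂ)) ∂(ρ x')) x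
          = 0))
    {p : Fin 4 → ℝ} (hp : PosLightlike p) {x : Fin 4 → ℝ} (hx : x ∈ O) {t : ℝ} (ht : 0 ≤ t) :
    (ρ (x + t • p)).map (mink p) = (ρ x).map (mink p) := by
  have hm : Measurable (mink p) := (continuous_mink_right p).measurable
  have hP : ∀ y, IsProbabilityMeasure ((ρ y).map (mink p)) := fun y =>
    Measure.isProbabilityMeasure_map hm.aemeasurable
  have hchar : ∀ (r : ℝ) (y : Fin 4 → ℝ), charFun ((ρ y).map (mink p)) r =
      ∫ β, Complex.exp (Complex.I * ((mink β (r • p) : ℝ) : ℂ)) ∂(ρ y) := by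
    intro r y
    rw [charFun_apply_real, integral_map hm.aemeasurable (by fun_prop)]
    congr 1 with β
    congr 1
    simp only [mink, Pi.smul_apply, smul_eq_mul]
    push_cast
    ring
  have hpos : ∀ r : ℝ, 0 < r →
      charFun ((ρ (x + t • p)).map (mink p)) r = charFun ((ρ x).map (mink p)) r := by
    intro r hr
    rw [hchar, hchar]
    obtain ⟨hsm, htr⟩ := hF _ (hp.smul hr)
    set F : (Fin 4 → ℝ) → ℂ :=
      fun y => ∫ β, Complex.exp (Complex.I * ((mink β (r • p) : ℝ) : ℂ)) ∂(ρ y)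
    refine eq_of_fderiv_apply_eq_zero_on_ray (O := O) (g := F)
      (fun y hy => (hsm.differentiableOn (by simp)).differentiableAt (hOopen.mem_nhds hy)) ?_
      (fun s hs => add_smul_mem_of_posLightlike hOopen hOconv hOV hx hp hs) ht
    intro y hy
    have h := htr y hy
    have hsum : p = ∑ ν, p ν • Pi.single ν (1 : ℝ) := by
      simpa using (pi_eq_sum_univ' p)
    rw [hsum, map_sum]
    simp only [map_smul, Complex.real_smul]
    simp only [pd, Pi.smul_apply, smul_eq_mul, Complex.ofReal_mul, mul_assoc,
      ← Finset.mul_sum] at h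
    exact (mul_eq_zero.1 h).resolve_left (by exact_mod_cast hr.ne')
  apply Measure.ext_of_charFun
  ext r
  rcases lt_trichotomy r 0 with hr | rfl | hr
  · have h := hpos (-r) (by linarith)
    rw [charFun_neg, charFun_neg] at h
    exact (starRingEnd ℂ).injective h
  · simp
  · exact hpos r hr

lemma fderiv_nullMoment_self {m : ℕ} {p x : Fin 4 → ℝ}
    (hd : DifferentiableAt ℝ (nullMoment ρ m p) x)
    (hinv : ∀ t : ℝ, 0 ≤ t → (ρ (x + t • p)).map (mink p) = (ρ x).map (mink p)) :
    fderiv ℝ (nullMoment ρ m p) x p = 0 := by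
  have hm : Measurable (mink p) := (continuous_mink_right p).measurable
  have hmap : ∀ y, nullMoment ρ m p y = ∫ s, s ^ m ∂((ρ y).map (mink p)) := fun y => by
    rw [integral_map hm.aemeasurable (by fun_prop), nullMoment]
  have h1 := hasDerivAt_comp_ray (g := nullMoment ρ m p) (x := x) (v := p) (t := 0) (by simpa)
  have h2 : HasDerivWithinAt (fun t : ℝ => nullMoment ρ m p (x + t • p)) 0 (Set.Ici 0) 0 :=
    (hasDerivWithinAt_const 0 _ (nullMoment ρ m p x)).congr
      (fun t ht => by rw [hmap, hmap, hinv t ht]) (by simp)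
  simpa using (uniqueDiffOn_Ici (0 : ℝ) 0 (by simp)).eq_deriv _ h1.hasDerivWithinAt h2

end Moments

lemma exists_spatial_orthogonal (u v : Fin 4 → ℝ) :
    ∃ f : Fin 4 → ℝ, f ≠ 0 ∧ f 0 = 0 ∧ mink f u = 0 ∧ mink f v = 0 := by
  let L : (Fin 4 → ℝ) →ₗ[ℝ] (Fin 3 → ℝ) :=
    { toFun := fun f => ![f 0, mink f u, mink f v]
      map_add' := fun f g => by
        ext i; fin_cases i <;> simp [mink] <;> ring
      map_smul' := fun r f => by
        ext i; fin_cases i <;> simp [mink] <;> ring }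
  obtain ⟨f, hf, hf0⟩ := Submodule.exists_mem_ne_zero_of_ne_bot
    (LinearMap.ker_ne_bot_of_finrank_lt (f := L) (by simp))
  have h : L f = 0 := hf
  exact ⟨f, hf0, congrFun h 0, congrFun h 1, congrFun h 2⟩

lemma mink_self_neg_of_spatial {f : Fin 4 → ℝ} (hf : f ≠ 0) (h0 : f 0 = 0) : mink f f < 0 := by
  by_contra h
  simp only [mink, h0] at h
  refine hf (funext fun i => ?_)
  have h1 : f 1 = 0 := by nlinarith [sq_nonneg (f 1), sq_nonneg (f 2), sq_nonneg (f 3)]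
  have h2 : f 2 = 0 := by nlinarith [sq_nonneg (f 1), sq_nonneg (f 2), sq_nonneg (f 3)]
  have h3 : f 3 = 0 := by nlinarith [sq_nonneg (f 1), sq_nonneg (f 2), sq_nonneg (f 3)]
  fin_cases i <;> assumption

lemma mink_pos_of_null_of_ne {u v : Fin 4 → ℝ} (hu0 : u 0 = 1) (hv0 : v 0 = 1)
    (hu : mink u u = 0) (hv : mink v v = 0) (huv : u ≠ v) : 0 < mink u v := by
  have h := mink_self_neg_of_spatial (sub_ne_zero.2 huv) (by simp [hu0, hv0])
  simp only [mink, Pi.sub_apply] at *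
  linarith

/-- The null curve through `v` tending to the direction of `u`. -/
lemma exists_null_curve {u v : Fin 4 → ℝ} (hu0 : u 0 = 1) (hv0 : v 0 = 1)
    (hu : mink u u = 0) (hv : mink v v = 0) (huv : u ≠ v) :
    ∃ (f : Fin 4 → ℝ) (c : ℝ), c ≠ 0 ∧
      ∀ s : ℝ, PosLightlike (v + s • f + s ^ 2 • c • u) := by
  obtain ⟨f, hf, hf0, hfu, hfv⟩ := exists_spatial_orthogonal u v
  have hff := mink_self_neg_of_spatial hf hf0
  have huv' := mink_pos_of_null_of_ne hu0 hv0 hu hv huv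
  set c := -mink f f / (2 * mink u v) with hc
  have hc0 : 0 < c := div_pos (by linarith) (by linarith)
  have hcf : 2 * c * mink u v = -mink f f := by rw [hc]; field_simp
  refine ⟨f, c, hc0.ne', fun s => ?_⟩
  have h0 : 0 < (v + s • f + s ^ 2 • c • u) 0 := by
    simp [hf0, hu0, hv0]
    positivity
  refine ⟨fun h => (congrFun h 0 ▸ h0).ne' rfl, ?_, h0⟩
  have hexp : mink (v + s • f + s ^ 2 • c • u) (v + s • f + s ^ 2 • c • u) =
      mink v v + 2 * s * mink f v + s ^ 2 * (mink f f + 2 * c * mink u v) +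
        2 * s ^ 3 * c * mink f u + s ^ 4 * c ^ 2 * mink u u := by
    simp only [mink, Pi.add_apply, Pi.smul_apply, smul_eq_mul]
    ring
  rw [hexp, hv, hu, hfu, hfv, hcf]
  ring

/-- Null moments in one null direction `u` are transported along every other null direction `v`,
as soon as they are bounded and each of them is transported along its own direction. -/
lemma fderiv_nullMoment_apply_eq_zero {ρ : (Fin 4 → ℝ) → Measure (Fin 4 → ℝ)}
    {O : Set (Fin 4 → ℝ)} {m : ℕ} (hOopen : IsOpen O)
    (hray : ∀ x ∈ O, ∀ p, PosLightlike p → ∀ t : ℝ, 0 ≤ t → x + t • p ∈ O)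
    (hint : ∀ p x, Integrable (fun β => mink p β ^ m) (ρ x))
    (hb : ∀ p, ∃ C, ∀ x, |nullMoment ρ m p x| ≤ C)
    (hd : ∀ p, PosLightlike p → ∀ x ∈ O, DifferentiableAt ℝ (nullMoment ρ m p) x)
    (htr : ∀ p, PosLightlike p → ∀ x ∈ O, fderiv ℝ (nullMoment ρ m p) x p = 0)
    {u v : Fin 4 → ℝ} (hu0 : u 0 = 1) (hv0 : v 0 = 1) (hu : mink u u = 0) (hv : mink v v = 0)
    {x : Fin 4 → ℝ} (hx : x ∈ O) : fderiv ℝ (nullMoment ρ m u) x v = 0 := by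
  rcases eq_or_ne u v with rfl | huv
  · exact htr u (posLightlike_of_zero_eq_one hu0 hu) x hx
  obtain ⟨f, c, hc, hn⟩ := exists_null_curve hu0 hv0 hu hv huv
  set n : ℝ → Fin 4 → ℝ := fun s => v + s • f + s ^ 2 • c • u
  replace hn : ∀ s, PosLightlike (n s) := hn
  set b : ℕ → Polynomial ℝ := natBasis (2 * m + 1)
  set S := Finset.range (2 * m + 1)
  have hmink : ∀ s β, mink (n s) β = mink v β + mink f β * s + c * mink u β * s ^ 2 := by
    intro s β
    simp only [n, mink, Pi.add_apply, Pi.smul_apply, smul_eq_mul]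
    ring
  have hcomb : ∀ (w : ℕ → ℝ) (y : Fin 4 → ℝ), ∑ j ∈ S, w j * nullMoment ρ m (n j) y =
      ∫ β, ∑ j ∈ S, w j * mink (n j) β ^ m ∂(ρ y) := by
    intro w y
    rw [integral_finsetSum _ fun j _ => (hint _ _).const_mul _]
    simp only [integral_const_mul, nullMoment]
  have hsum : ∀ s, nullMoment ρ m (n s) =
      fun y => ∑ j ∈ S, (b j).eval s * nullMoment ρ m (n j) y := by
    intro s
    ext y
    rw [hcomb, nullMoment]
    congr 1 with β
    simp only [hmink]
    exact quadratic_pow_eq_sum _ _ _ _ _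
  have hlead : (fun y => c ^ m * nullMoment ρ m u y) =
      fun y => ∑ j ∈ S, (b j).coeff (m * 2) * nullMoment ρ m (n j) y := by
    ext y
    rw [hcomb, nullMoment, ← integral_const_mul]
    congr 1 with β
    simp only [hmink]
    rw [← mul_pow]
    exact leading_pow_eq_sum _ _ _ _
  have hdc : ∀ (w : ℕ → ℝ), ∀ y ∈ O,
      DifferentiableAt ℝ (fun y => ∑ j ∈ S, w j * nullMoment ρ m (n j) y) y := fun w y hy =>
    DifferentiableAt.fun_sum fun j _ => (hd _ (hn j) y hy).const_mul _
  have hfd : ∀ (w : ℕ → ℝ), ∀ y ∈ O, ∀ z,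
      fderiv ℝ (fun y => ∑ j ∈ S, w j * nullMoment ρ m (n j) y) y z =
        ∑ j ∈ S, w j * fderiv ℝ (nullMoment ρ m (n j)) y z := by
    intro w y hy z
    rw [fderiv_fun_sum fun (j : ℕ) _ => (hd _ (hn j) y hy).const_mul _, sum_apply]
    refine Finset.sum_congr rfl fun j _ => ?_
    rw [fderiv_const_mul (hd _ (hn j) y hy)]
    rfl
  set A : ℕ → (Fin 4 → ℝ) → ℝ := fun k y => ∑ j ∈ S, (b j).coeff k * nullMoment ρ m (n j) y
  have hcoeff : ∀ k, ∀ y ∈ O, ∀ z, fderiv ℝ (A k) y z =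
      (∑ j ∈ S, Polynomial.C (fderiv ℝ (nullMoment ρ m (n j)) y z) * b j).coeff k := by
    intro k y hy z
    rw [hfd _ y hy z]
    rw [Polynomial.finsetSum_coeff]
    exact Finset.sum_congr rfl fun j _ => by rw [Polynomial.coeff_C_mul, mul_comm]
  have hrec : ∀ y ∈ O, fderiv ℝ (A 0) y v = 0 ∧
      fderiv ℝ (A 1) y v + fderiv ℝ (A 0) y f = 0 ∧ ∀ k,
        fderiv ℝ (A (k + 2)) y v + fderiv ℝ (A (k + 1)) y f + fderiv ℝ (A k) y (c • u) = 0 := by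
    intro y hy
    simp only [hcoeff _ y hy]
    refine coeff_recursion_of_eval_eq_zero fun s => ?_
    have h := htr _ (hn s) y hy
    change fderiv ℝ (nullMoment ρ m (n s)) y (v + s • f + s ^ 2 • c • u) = 0 at h
    rw [map_add, map_add, map_smul, map_smul _ (s ^ 2), hsum, hfd _ y hy, hfd _ y hy,
      hfd _ y hy] at h
    simpa only [Polynomial.eval_finsetSum, Polynomial.eval_mul, Polynomial.eval_C, smul_eq_mul,
      mul_comm (Polynomial.eval _ _)] using h
  have hAb : ∀ k, ∃ C, ∀ y ∈ O, |A k y| ≤ C := by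
    intro k
    choose C hC using hb
    refine ⟨∑ j ∈ S, |(b j).coeff k| * C (n j), fun y _ => ?_⟩
    refine (Finset.abs_sum_le_sum_abs _ _).trans (Finset.sum_le_sum fun j _ => ?_)
    rw [abs_mul]
    exact mul_le_mul_of_nonneg_left (hC _ y) (abs_nonneg _)
  have hA := fderiv_apply_eq_zero_of_transport_recursion hOopen
    (fun y hy => hray y hy v (posLightlike_of_zero_eq_one hv0 hv))
    (fun k y hy => hdc _ y hy) hAb (fun y hy => (hrec y hy).1)
    (fun y hy => by linarith [(hrec y hy).2.1])
    (fun k y hy => by linarith [(hrec y hy).2.2 k]) (m * 2) x hx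
  rw [← hlead, fderiv_const_mul (hd u (posLightlike_of_zero_eq_one hu0 hu) x hx)] at hA
  exact (mul_eq_zero.1 hA).resolve_left (pow_ne_zero m hc)

lemma eq_zero_of_forall_null {L : (Fin 4 → ℝ) →L[ℝ] ℝ}
    (hL : ∀ v : Fin 4 → ℝ, v 0 = 1 → mink v v = 0 → L v = 0) : L = 0 := by
  have hp : ∀ i : Fin 4, i ≠ 0 → L (Pi.single 0 1) + L (Pi.single i 1) = 0 ∧
      L (Pi.single 0 1) - L (Pi.single i 1) = 0 := by
    intro i hi
    rw [← map_add, ← map_sub]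
    constructor <;> apply hL <;> fin_cases i <;> simp [mink] at hi ⊢
  have h0 : ∀ i : Fin 4, L (Pi.single i 1) = 0 := by
    intro i
    by_cases hi : i = 0
    · subst hi; linarith [hp 1 (by decide)]
    · linarith [hp i hi]
  ext x
  rw [pi_eq_sum_univ' x, map_sum]
  simp [h0]

/-- Proposition 5.2 (measure-family form): for a family of thermal reference
measures (ρ_x) with compact temperature support B ⊆ V₊ whose lightlike
characteristic functions F_p satisfy the transport and wave equations, either
all lightlike moments x ↦ ∫ (e·β)^m dρ_x are constant on 𝒪, or 𝒪 is
contained in a timelike simplicial cone, i.e. in an intersection of four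
characteristic half-spaces with linearly independent positive lightlike
normals. -/
theorem local_equilibrium_region_trivial_or_in_simplicial_cone
    (O : Set (Fin 4 → ℝ)) (hOopen : IsOpen O) (hOconv : Convex ℝ O)
    (hOV : Vplus ⊆ O)
    (B : Set (Fin 4 → ℝ)) (hBc : IsCompact B) (hBV : B ⊆ Vplus)
    (ρ : (Fin 4 → ℝ) → Measure (Fin 4 → ℝ))
    (hprob : ∀ x, IsProbabilityMeasure (ρ x))
    (hsupp : ∀ x, ρ x Bᶜ = 0)
    (hFp : ∀ p : Fin 4 → ℝ, PosLightlike p →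
      ContDiffOn ℝ (⊤ : ℕ∞)
        (fun x => ∫ β, Complex.exp (Complex.I * ((mink β p : ℝ) : ℂ)) ∂(ρ x)) O ∧
      (∀ x ∈ O, ∑ ν : Fin 4, (p ν : ℂ) *
        pd ν (fun x' => ∫ β, Complex.exp (Complex.I * ((mink β p : ℝ) : ℂ)) ∂(ρ x')) x
          = 0) ∧
      (∀ x ∈ O,
        box (fun x' => ∫ β, Complex.exp (Complex.I * ((mink β p : ℝ) : ℂ)) ∂(ρ x')) x
          = 0))
    (hmom : ∀ e : EuclideanSpace ℝ (Fin 3), ‖e‖ = 1 → ∀ m : ℕ,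
      ContDiffOn ℝ (⊤ : ℕ∞) (fun x => ∫ β, (mink (lightOne e) β) ^ m ∂(ρ x)) O) :
    (∀ e : EuclideanSpace ℝ (Fin 3), ‖e‖ = 1 → ∀ m : ℕ, ∀ x ∈ O, ∀ y ∈ O,
        ∫ β, (mink (lightOne e) β) ^ m ∂(ρ x)
          = ∫ β, (mink (lightOne e) β) ^ m ∂(ρ y)) ∨
    (∃ (e : Fin 4 → (Fin 4 → ℝ)) (c : Fin 4 → ℝ),
        LinearIndependent ℝ e ∧ (∀ i, PosLightlike (e i)) ∧
        O ⊆ ⋂ i, {x : Fin 4 → ℝ | c i ≤ mink (e i) x}) := by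
  left
  have hray : ∀ x ∈ O, ∀ p, PosLightlike p → ∀ t : ℝ, 0 ≤ t → x + t • p ∈ O :=
    fun x hx p hp t ht => add_smul_mem_of_posLightlike hOopen hOconv hOV hx hp ht
  intro e he m x hx y hy
  have hd : ∀ p, PosLightlike p → ∀ x ∈ O, DifferentiableAt ℝ (nullMoment ρ m p) x :=
    fun p hp x hx => differentiableAt_nullMoment hOopen hmom hp m hx
  have htr : ∀ p, PosLightlike p → ∀ x ∈ O, fderiv ℝ (nullMoment ρ m p) x p = 0 :=
    fun p hp x hx => fderiv_nullMoment_self (hd p hp x hx) fun t ht =>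
      map_mink_add_smul hprob hOopen hOconv hOV (fun p hp => ⟨(hFp p hp).1, (hFp p hp).2.1⟩)
        hp hx ht
  have he0 : mink (lightOne e) (lightOne e) = 0 := mink_lightOne_self he
  have hzero : ∀ z ∈ O, fderiv ℝ (nullMoment ρ m (lightOne e)) z = 0 := fun z hz =>
    eq_zero_of_forall_null fun v hv0 hv =>
      fderiv_nullMoment_apply_eq_zero hOopen hray
        (fun p x => integrable_mink_pow hBc hprob hsupp p x m)
        (fun p => exists_bound_nullMoment hBc hprob hsupp p m) hd htr rfl hv0 he0 hv hz
  exact hOopen.is_const_of_fderiv_eq_zero (𝕜 := ℝ) hOconv.isPreconnected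
    (fun z hz => (hd _ (posLightlike_of_zero_eq_one rfl he0) z hz).differentiableWithinAt)
    hzero hx hy
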